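/- The following identity of formal power series in q holds: ∑_{r,s ≥ 0} q^{r² − rs + s² + s} [r+s choose r]_{q³} / ((q)_{r+s} (q)_{r+s+1}) = 1 / ( (q;q)_∞ · θ(q;q⁶) · θ(q²;q⁶) ). -/

import Mathlib

noncomputable section

open PowerSeries

/-- The coefficientwise (product) topology on `ℚ[[q]]`. -/
instance : TopologicalSpace (PowerSeries ℚ) :=
  inferInstanceAs (TopologicalSpace ((Unit →₀ ℕ) → ℚ))

/-- `(q;q)_n = ∏_{t=0}^{n-1} (1 - q^{t+1})` in `ℚ[[q]]`. -/
def qp (n : ℕ) : PowerSeries ℚ :=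
  ∏ t ∈ Finset.range n, (1 - (X : PowerSeries ℚ) ^ (t + 1))

/-- `(q³;q³)_n = ∏_{t=0}^{n-1} (1 - q^{3(t+1)})` in `ℚ[[q]]`. -/
def qp3 (n : ℕ) : PowerSeries ℚ :=
  ∏ t ∈ Finset.range n, (1 - (X : PowerSeries ℚ) ^ (3 * (t + 1)))

/-- The Gaussian binomial coefficient in base `q³`:
`[n choose k]_{q³} = (q³;q³)_n / ((q³;q³)_k (q³;q³)_{n−k})` for `0 ≤ k ≤ n`, else `0`. -/
def gbinom3 (n k : ℕ) : PowerSeries ℚ :=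
  if k ≤ n then qp3 n * (qp3 k * qp3 (n - k))⁻¹ else 0

/-- `(q;q)_∞ = ∏_{t≥0}(1 − q^{t+1})`. -/
def qpInf : PowerSeries ℚ := ∏' t : ℕ, (1 - (X : PowerSeries ℚ) ^ (t + 1))

/-- For `0 < j < N`, the theta function
`θ(q^j;q^N) = (q^j;q^N)_∞ (q^{N−j};q^N)_∞ = ∏_{t≥0}(1−q^{j+Nt}) · ∏_{t≥0}(1−q^{(N−j)+Nt})`. -/
def theta (j N : ℕ) : PowerSeries ℚ :=
  (∏' t : ℕ, (1 - (X : PowerSeries ℚ) ^ (j + N * t))) *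
    (∏' t : ℕ, (1 - (X : PowerSeries ℚ) ^ ((N - j) + N * t)))


section Topology

open Filter Topology

instance : IsTopologicalRing (PowerSeries ℚ) :=
  PowerSeries.WithPiTopology.instIsTopologicalRing ℚ

instance : T3Space (PowerSeries ℚ) :=
  inferInstanceAs (T3Space ((Unit →₀ ℕ) → ℚ))

theorem continuous_coeff_rat (d : ℕ) : Continuous (coeff (R := ℚ) d) :=
  PowerSeries.WithPiTopology.continuous_coeff ℚ d

theorem summable_of_X_pow_dvd {ι : Type*} {f : ι → PowerSeries ℚ} {e : ι → ℕ}
    (hf : ∀ i, X ^ e i ∣ f i) (he : ∀ d, {i | e i ≤ d}.Finite) : Summable f := by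
  refine (PowerSeries.WithPiTopology.summable_iff_summable_coeff (R := ℚ)).2 fun d => ?_
  refine summable_of_hasFiniteSupport ((he d).subset fun i hi => ?_)
  by_contra hlt
  exact hi (X_pow_dvd_iff.1 (hf i) d (not_le.1 hlt))

theorem summable_nat_of_X_pow_dvd {f : ℕ → PowerSeries ℚ} (hf : ∀ n, X ^ n ∣ f n) : Summable f :=
  summable_of_X_pow_dvd hf fun d => Set.finite_Iic d

theorem summable_prod_of_X_pow_dvd {f : ℕ × ℕ → PowerSeries ℚ} {e : ℕ × ℕ → ℕ} (c : ℕ)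
    (hf : ∀ p, X ^ e p ∣ f p) (he : ∀ p, p.1 + p.2 ≤ c * e p) : Summable f := by
  refine summable_of_X_pow_dvd hf fun d => ?_
  refine ((Set.finite_Iic (c * d)).prod (Set.finite_Iic (c * d))).subset fun p hp => ?_
  have h1 := he p
  have h2 : c * e p ≤ c * d := Nat.mul_le_mul_left c hp
  exact ⟨Set.mem_Iic.2 (by omega), Set.mem_Iic.2 (by omega)⟩

theorem X_pow_dvd_tsum {ι : Type*} {f : ι → PowerSeries ℚ} {d : ℕ} (hs : Summable f)
    (hf : ∀ i, X ^ d ∣ f i) : X ^ d ∣ ∑' i, f i := by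
  refine X_pow_dvd_iff.2 fun m hm => ?_
  have h := hs.hasSum.map (coeff (R := ℚ) m).toAddMonoidHom (continuous_coeff_rat m)
  refine h.unique ?_
  convert hasSum_zero using 1
  funext i
  exact X_pow_dvd_iff.1 (hf i) m hm

theorem tendsto_of_X_pow_dvd_sub {u : ℕ → PowerSeries ℚ} {a : PowerSeries ℚ} (h : ∀ n, X ^ n ∣ u n - a) :
    Tendsto u atTop (𝓝 a) := by
  refine (PowerSeries.WithPiTopology.tendsto_iff_coeff_tendsto (R := ℚ) u atTop a).2 fun d => ?_
  refine tendsto_const_nhds.congr' ?_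
  filter_upwards [eventually_gt_atTop d] with n hn
  have := X_pow_dvd_iff.1 (h n) d hn
  rw [map_sub, sub_eq_zero] at this
  exact this.symm

theorem tsum_prod_eq_tsum_antidiagonal {f : ℕ × ℕ → PowerSeries ℚ} (hf : Summable f) :
    ∑' p, f p = ∑' n, ∑ p ∈ Finset.HasAntidiagonal.antidiagonal n, f p := by
  conv_rhs => congr; ext; rw [← Finset.sum_finset_coe, ← tsum_fintype (L := .unconditional _)]
  rw [← Finset.HasAntidiagonal.sigmaAntidiagonalEquivProd.tsum_eq f]
  exact (Finset.HasAntidiagonal.sigmaAntidiagonalEquivProd.summable_iff.2 hf).tsum_sigma'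
    fun n => (hasSum_fintype _).summable

theorem multipliable_one_sub_X_pow_linear (a : ℕ) {b : ℕ} (hb : 0 < b) :
    Multipliable fun t : ℕ => 1 - (X : PowerSeries ℚ) ^ (a + b * t) := by
  simp_rw [sub_eq_add_neg]
  refine PowerSeries.WithPiTopology.multipliable_one_add_of_tendsto_order_atTop_nhds_top ℚ ?_
  refine ENat.tendsto_nhds_top_iff_natCast_lt.mpr fun n => eventually_atTop.mpr ⟨n + 1, ?_⟩
  intro m hm
  rw [order_neg, order_X_pow]
  norm_cast
  nlinarith

end Topology

section Recurrences

open Finset.HasAntidiagonal (antidiagonal mem_antidiagonal)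

theorem constantCoeff_one_sub_X_pow_succ (n : ℕ) :
    constantCoeff (1 - (X : PowerSeries ℚ) ^ (n + 1)) = 1 := by
  simp

theorem one_sub_X_pow_succ_ne_zero (n : ℕ) : 1 - (X : PowerSeries ℚ) ^ (n + 1) ≠ 0 := by
  intro h
  have := constantCoeff_one_sub_X_pow_succ n
  rw [h] at this
  simp at this

theorem qp_succ (n : ℕ) : qp (n + 1) = qp n * (1 - X ^ (n + 1)) :=
  Finset.prod_range_succ _ _

theorem qp3_succ (n : ℕ) : qp3 (n + 1) = qp3 n * (1 - X ^ (3 * (n + 1))) :=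
  Finset.prod_range_succ _ _

theorem constantCoeff_qp (n : ℕ) : constantCoeff (qp n) = 1 := by
  simp [qp, map_prod]

theorem constantCoeff_qp3 (n : ℕ) : constantCoeff (qp3 n) = 1 := by
  simp [qp3, map_prod]

theorem qp_zero : qp 0 = 1 := Finset.prod_range_zero _

theorem qp3_zero : qp3 0 = 1 := Finset.prod_range_zero _

theorem qp_inv_mul (n : ℕ) : (qp n)⁻¹ * qp n = 1 :=
  PowerSeries.inv_mul_cancel _ (by simp [constantCoeff_qp])

theorem qp3_inv_mul (n : ℕ) : (qp3 n)⁻¹ * qp3 n = 1 :=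
  PowerSeries.inv_mul_cancel _ (by simp [constantCoeff_qp3])

theorem qp_inv_zero : (qp 0)⁻¹ = 1 := by
  simp [qp_zero]

theorem qp3_inv_zero : (qp3 0)⁻¹ = 1 := by
  simp [qp3_zero]

theorem qp_inv_succ_mul (n : ℕ) : (qp (n + 1))⁻¹ * (1 - X ^ (n + 1)) = (qp n)⁻¹ := by
  have h := qp_inv_mul (n + 1)
  rw [qp_succ] at h ⊢
  linear_combination (qp n)⁻¹ * h - (qp n * (1 - X ^ (n + 1)))⁻¹ * (1 - X ^ (n + 1)) * qp_inv_mul n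

theorem qp3_inv_succ_mul (n : ℕ) :
    (qp3 (n + 1))⁻¹ * (1 - X ^ (3 * (n + 1))) = (qp3 n)⁻¹ := by
  have h := qp3_inv_mul (n + 1)
  rw [qp3_succ] at h ⊢
  linear_combination (qp3 n)⁻¹ * h -
    (qp3 n * (1 - X ^ (3 * (n + 1))))⁻¹ * (1 - X ^ (3 * (n + 1))) * qp3_inv_mul n

/-- The summand `q^{r²−rs+s²+s} / ((q³;q³)_r (q³;q³)_s)`. -/
def cubicTerm (r s : ℕ) : PowerSeries ℚ :=
  X ^ (r ^ 2 + s ^ 2 + s - r * s) * ((qp3 r)⁻¹ * (qp3 s)⁻¹)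

/-- The sum of `cubicTerm r s` over `r + s = n`, a Rogers–Szegő polynomial in base `q⁻³` up to
normalization. -/
def cubicSum (n : ℕ) : PowerSeries ℚ :=
  ∑ p ∈ antidiagonal n, cubicTerm p.1 p.2

theorem cubic_exponent_add (r s : ℕ) :
    r ^ 2 + s ^ 2 + s - r * s + r * s = r ^ 2 + s ^ 2 + s := by
  refine Nat.sub_add_cancel ?_
  zify
  nlinarith [sq_nonneg ((r : ℤ) - s), sq_nonneg (r : ℤ), sq_nonneg (s : ℤ)]

theorem cubicTerm_succ_left (r s : ℕ) :
    (1 - X ^ (3 * (r + 1))) * X ^ (3 * s) * cubicTerm (r + 1) s =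
      X ^ (2 * (r + s) + 1) * cubicTerm r s := by
  have hX : (X : PowerSeries ℚ) ^ (3 * s) * X ^ ((r + 1) ^ 2 + s ^ 2 + s - (r + 1) * s) =
      X ^ (2 * (r + s) + 1) * X ^ (r ^ 2 + s ^ 2 + s - r * s) := by
    rw [← pow_add, ← pow_add]
    congr 1
    linarith [cubic_exponent_add r s, cubic_exponent_add (r + 1) s]
  unfold cubicTerm
  linear_combination (X ^ (3 * s) * X ^ ((r + 1) ^ 2 + s ^ 2 + s - (r + 1) * s) * (qp3 s)⁻¹) *
    qp3_inv_succ_mul r + (qp3 r)⁻¹ * (qp3 s)⁻¹ * hX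

theorem cubicTerm_succ_right (r s : ℕ) :
    (1 - X ^ (3 * (s + 1))) * X ^ (3 * r) * cubicTerm r (s + 1) =
      X ^ (2 * (r + s) + 2) * cubicTerm r s := by
  have hX : (X : PowerSeries ℚ) ^ (3 * r) * X ^ (r ^ 2 + (s + 1) ^ 2 + (s + 1) - r * (s + 1)) =
      X ^ (2 * (r + s) + 2) * X ^ (r ^ 2 + s ^ 2 + s - r * s) := by
    rw [← pow_add, ← pow_add]
    congr 1
    linarith [cubic_exponent_add r s, cubic_exponent_add r (s + 1)]
  unfold cubicTerm
  linear_combination (X ^ (3 * r) * X ^ (r ^ 2 + (s + 1) ^ 2 + (s + 1) - r * (s + 1)) *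
    (qp3 r)⁻¹) * qp3_inv_succ_mul s + (qp3 r)⁻¹ * (qp3 s)⁻¹ * hX

theorem cubicTerm_succ_succ (r s : ℕ) :
    (1 - X ^ (3 * (r + 1))) * (1 - X ^ (3 * (s + 1))) * cubicTerm (r + 1) (s + 1) =
      X ^ (r + s + 2) * cubicTerm r s := by
  have hX : (X : PowerSeries ℚ) ^
        ((r + 1) ^ 2 + (s + 1) ^ 2 + (s + 1) - (r + 1) * (s + 1)) =
      X ^ (r + s + 2) * X ^ (r ^ 2 + s ^ 2 + s - r * s) := by
    rw [← pow_add]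
    congr 1
    linarith [cubic_exponent_add r s, cubic_exponent_add (r + 1) (s + 1)]
  unfold cubicTerm
  rw [hX]
  linear_combination X ^ (r + s + 2) * X ^ (r ^ 2 + s ^ 2 + s - r * s) *
    ((1 - X ^ (3 * (s + 1))) * (qp3 (s + 1))⁻¹ * qp3_inv_succ_mul r +
      (qp3 r)⁻¹ * qp3_inv_succ_mul s)

theorem cubicSum_weight_left (n : ℕ) :
    ∑ p ∈ antidiagonal (n + 1),
        (1 - X ^ (3 * p.1)) * X ^ (3 * p.2) * cubicTerm p.1 p.2 =
      X ^ (2 * n + 1) * cubicSum n := by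
  rw [Finset.Nat.sum_antidiagonal_succ, cubicSum, Finset.mul_sum]
  simp only [mul_zero, pow_zero, sub_self, zero_mul, zero_add]
  refine Finset.sum_congr rfl fun p hp => ?_
  rw [cubicTerm_succ_left, mem_antidiagonal.1 hp]

theorem cubicSum_weight_right (n : ℕ) :
    ∑ p ∈ antidiagonal (n + 1),
        (1 - X ^ (3 * p.2)) * X ^ (3 * p.1) * cubicTerm p.1 p.2 =
      X ^ (2 * n + 2) * cubicSum n := by
  rw [Finset.Nat.sum_antidiagonal_succ', cubicSum, Finset.mul_sum]
  simp only [mul_zero, pow_zero, sub_self, zero_mul, zero_add]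
  refine Finset.sum_congr rfl fun p hp => ?_
  rw [cubicTerm_succ_right, mem_antidiagonal.1 hp]

theorem cubicSum_weight_both (n : ℕ) :
    ∑ p ∈ antidiagonal (n + 2),
        (1 - X ^ (3 * p.1)) * (1 - X ^ (3 * p.2)) * cubicTerm p.1 p.2 =
      X ^ (n + 2) * cubicSum n := by
  rw [Finset.Nat.sum_antidiagonal_succ, Finset.Nat.sum_antidiagonal_succ', cubicSum,
    Finset.mul_sum]
  simp only [mul_zero, pow_zero, sub_self, zero_mul, zero_add]
  refine Finset.sum_congr rfl fun p hp => ?_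
  rw [cubicTerm_succ_succ, mem_antidiagonal.1 hp]

theorem cubicSum_rec (n : ℕ) :
    (1 - X ^ (3 * (n + 2))) * cubicSum (n + 2) =
      X ^ (2 * n + 3) * (1 + X) * cubicSum (n + 1) + X ^ (n + 2) * cubicSum n := by
  have key : (1 - X ^ (3 * (n + 2))) * cubicSum (n + 2) =
      (∑ p ∈ antidiagonal (n + 2),
        (1 - X ^ (3 * p.1)) * X ^ (3 * p.2) * cubicTerm p.1 p.2) +
      (∑ p ∈ antidiagonal (n + 2),
        (1 - X ^ (3 * p.2)) * X ^ (3 * p.1) * cubicTerm p.1 p.2) +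
      ∑ p ∈ antidiagonal (n + 2),
        (1 - X ^ (3 * p.1)) * (1 - X ^ (3 * p.2)) * cubicTerm p.1 p.2 := by
    rw [cubicSum, Finset.mul_sum, ← Finset.sum_add_distrib, ← Finset.sum_add_distrib]
    refine Finset.sum_congr rfl fun p hp => ?_
    rw [← mem_antidiagonal.1 hp]
    ring
  rw [key, cubicSum_weight_left (n + 1), cubicSum_weight_right (n + 1), cubicSum_weight_both n]
  ring

/-- The coefficients of `(t³;q³)_∞ / (t;q)_∞ = ∏_{k ≥ 0} (1 + q^k t + q^{2k} t²)` as a power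
series in `t`. -/
def trinomialCoeff : ℕ → PowerSeries ℚ
  | 0 => 1
  | 1 => (1 - X)⁻¹
  | n + 2 => (X ^ (n + 1) * trinomialCoeff (n + 1) + X ^ n * trinomialCoeff n) *
      (1 - X ^ (n + 2))⁻¹

theorem trinomialCoeff_one : (1 - X) * trinomialCoeff 1 = 1 := by
  rw [trinomialCoeff]
  exact PowerSeries.mul_inv_cancel _ (by simp)

theorem trinomialCoeff_rec (n : ℕ) :
    (1 - X ^ (n + 2)) * trinomialCoeff (n + 2) =
      X ^ (n + 1) * trinomialCoeff (n + 1) + X ^ n * trinomialCoeff n := by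
  rw [trinomialCoeff]
  linear_combination (X ^ (n + 1) * trinomialCoeff (n + 1) + X ^ n * trinomialCoeff n) *
    PowerSeries.mul_inv_cancel (1 - (X : PowerSeries ℚ) ^ (n + 2)) (by simp)

/-- The summand `q^{(m+k)(m+1)} e_k / (q)_m`, where `e_k` is `trinomialCoeff k`. -/
def durfeeTerm (m k : ℕ) : PowerSeries ℚ :=
  X ^ ((m + k) * (m + 1)) * ((qp m)⁻¹ * trinomialCoeff k)

/-- The sum of `durfeeTerm m k` over `m + k = n`. -/
def durfeeSum (n : ℕ) : PowerSeries ℚ :=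
  ∑ p ∈ antidiagonal n, durfeeTerm p.1 p.2

/-- The sum of `q^m * durfeeTerm m k` over `m + k = n`. -/
def durfeeSumShift (n : ℕ) : PowerSeries ℚ :=
  ∑ p ∈ antidiagonal n, X ^ p.1 * durfeeTerm p.1 p.2

theorem durfeeTerm_succ_left (m k : ℕ) :
    (1 - X ^ (m + 1)) * durfeeTerm (m + 1) k = X ^ (m + k + m + 2) * durfeeTerm m k := by
  unfold durfeeTerm
  rw [show (m + 1 + k) * (m + 1 + 1) = (m + k) * (m + 1) + (m + k + m + 2) by ring, pow_add]
  linear_combination X ^ ((m + k) * (m + 1)) * X ^ (m + k + m + 2) * trinomialCoeff k *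
    qp_inv_succ_mul m

theorem durfeeTerm_one (m : ℕ) :
    (1 - X) * durfeeTerm m 1 = X ^ (m + 1) * durfeeTerm m 0 := by
  unfold durfeeTerm
  rw [show (m + 1) * (m + 1) = (m + 0) * (m + 1) + (m + 1) by ring, pow_add, trinomialCoeff.eq_1]
  linear_combination X ^ ((m + 0) * (m + 1)) * X ^ (m + 1) * (qp m)⁻¹ * trinomialCoeff_one

theorem durfeeTerm_add_two (m k : ℕ) :
    (1 - X ^ (k + 2)) * durfeeTerm m (k + 2) =
      X ^ (m + k + 2) * durfeeTerm m (k + 1) + X ^ (m + k + 2) * (X ^ m * durfeeTerm m k) := by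
  unfold durfeeTerm
  rw [show (m + (k + 2)) * (m + 1) = (m + k) * (m + 1) + 2 * (m + 1) by ring,
    show (m + (k + 1)) * (m + 1) = (m + k) * (m + 1) + (m + 1) by ring, pow_add, pow_add]
  linear_combination X ^ ((m + k) * (m + 1)) * X ^ (2 * (m + 1)) * (qp m)⁻¹ *
    trinomialCoeff_rec k

theorem durfeeSum_succ_sub (n : ℕ) :
    durfeeSum (n + 1) - durfeeSumShift (n + 1) = X ^ (n + 2) * durfeeSumShift n := by
  have h : durfeeSum (n + 1) - durfeeSumShift (n + 1) =
      ∑ p ∈ antidiagonal (n + 1), (1 - X ^ p.1) * durfeeTerm p.1 p.2 := by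
    rw [durfeeSum, durfeeSumShift, ← Finset.sum_sub_distrib]
    exact Finset.sum_congr rfl fun p _ => by ring
  rw [h, Finset.Nat.sum_antidiagonal_succ, durfeeSumShift, Finset.mul_sum]
  simp only [pow_zero, sub_self, zero_mul, zero_add]
  refine Finset.sum_congr rfl fun p hp => ?_
  rw [durfeeTerm_succ_left, ← mem_antidiagonal.1 hp]
  ring

theorem durfeeSum_weight_right (n : ℕ) :
    ∑ p ∈ antidiagonal (n + 2), (1 - X ^ p.2) * durfeeTerm p.1 p.2 =
      X ^ (n + 2) * durfeeSum (n + 1) + X ^ (n + 2) * durfeeSumShift n := by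
  rw [Finset.Nat.sum_antidiagonal_succ', durfeeSum, Finset.Nat.sum_antidiagonal_succ',
    Finset.Nat.sum_antidiagonal_succ', durfeeSumShift]
  simp only [pow_zero, sub_self, zero_mul, zero_add, pow_one]
  rw [durfeeTerm_one, mul_add, Finset.mul_sum, Finset.mul_sum,
    add_assoc (X ^ (n + 2) * durfeeTerm (n + 1) 0), ← Finset.sum_add_distrib]
  congr 1
  refine Finset.sum_congr rfl fun p hp => ?_
  rw [add_assoc p.2, durfeeTerm_add_two, mem_antidiagonal.1 hp]

theorem durfeeSum_rec_shift (n : ℕ) :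
    (1 - X ^ (n + 2)) * durfeeSum (n + 2) =
      X ^ (n + 2) * ((1 + X ^ (n + 2)) * durfeeSum (n + 1) + durfeeSumShift n) := by
  have key : (1 - X ^ (n + 2)) * durfeeSum (n + 2) =
      (∑ p ∈ antidiagonal (n + 2), (1 - X ^ p.2) * durfeeTerm p.1 p.2) +
      ∑ p ∈ antidiagonal (n + 2), X ^ p.2 * ((1 - X ^ p.1) * durfeeTerm p.1 p.2) := by
    rw [durfeeSum, Finset.mul_sum, ← Finset.sum_add_distrib]
    refine Finset.sum_congr rfl fun p hp => ?_
    rw [← mem_antidiagonal.1 hp]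
    ring
  have left : ∑ p ∈ antidiagonal (n + 2), X ^ p.2 * ((1 - X ^ p.1) * durfeeTerm p.1 p.2) =
      X ^ (2 * n + 4) * durfeeSum (n + 1) := by
    rw [Finset.Nat.sum_antidiagonal_succ, durfeeSum, Finset.mul_sum]
    simp only [pow_zero, sub_self, zero_mul, mul_zero, zero_add]
    refine Finset.sum_congr rfl fun p hp => ?_
    rw [durfeeTerm_succ_left, show 2 * n + 4 = 2 * (p.1 + p.2) + 2 by
      rw [mem_antidiagonal.1 hp]; ring]
    ring
  rw [key, left, durfeeSum_weight_right]
  ring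

theorem durfeeSum_zero : durfeeSum 0 = 1 := by
  simp [durfeeSum, durfeeTerm, trinomialCoeff, qp_zero]

theorem durfeeSumShift_zero : durfeeSumShift 0 = 1 := by
  simp [durfeeSumShift, durfeeTerm, trinomialCoeff, qp_zero]

theorem cubicSum_zero : cubicSum 0 = 1 := by
  simp [cubicSum, cubicTerm, qp3_zero]

theorem durfeeSum_one : (1 - X) * durfeeSum 1 = X + X ^ 2 := by
  have h := qp_inv_succ_mul 0
  simp only [zero_add, pow_one, qp_inv_zero] at h
  have h1 := trinomialCoeff_one
  simp [durfeeSum, durfeeTerm, trinomialCoeff.eq_1, qp_zero, Finset.Nat.antidiagonal_succ]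
  linear_combination X * h1 + X ^ 2 * h

theorem cubicSum_one : (1 - X ^ 3) * cubicSum 1 = X + X ^ 2 := by
  have h := qp3_inv_succ_mul 0
  simp only [zero_add, mul_one, qp3_inv_zero] at h
  simp [cubicSum, cubicTerm, qp3_zero, Finset.Nat.antidiagonal_succ]
  linear_combination (X + X ^ 2) * h

theorem durfeeSum_rec (n : ℕ) :
    (1 - X ^ (n + 2)) * durfeeSum (n + 2) =
      X ^ (n + 2) * (X ^ (n + 1) * (1 + X) * durfeeSum (n + 1) +
        (1 + X ^ (n + 1) + X ^ (2 * n + 2)) * durfeeSum n) := by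
  cases n with
  | zero =>
    have h := durfeeSum_rec_shift 0
    simp only [durfeeSumShift_zero, durfeeSum_zero, zero_add] at h ⊢
    linear_combination h + X ^ 2 * durfeeSum_one
  | succ n =>
    linear_combination durfeeSum_rec_shift (n + 1) - X ^ (n + 3) * durfeeSum_succ_sub n +
      X ^ (n + 3) * durfeeSum_rec_shift n

theorem qp3_mul_cubicSum_eq (n : ℕ) : qp3 n * cubicSum n = qp n * durfeeSum n := by
  induction n using Nat.strong_induction_on with
  | _ n ih =>
    match n with
    | 0 => rw [cubicSum_zero, durfeeSum_zero, qp3_zero, qp_zero]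
    | 1 =>
      rw [qp_succ, qp3_succ, qp_zero, qp3_zero]
      linear_combination cubicSum_one - durfeeSum_one
    | n + 2 =>
      have h0 := ih n (by omega)
      have h1 := ih (n + 1) (by omega)
      rw [qp_succ (n + 1), qp3_succ (n + 1)]
      rw [qp_succ, qp3_succ] at h1 ⊢
      linear_combination qp3 n * (1 - X ^ (3 * (n + 1))) * cubicSum_rec n -
        qp n * (1 - X ^ (n + 1)) * durfeeSum_rec n +
        X ^ (2 * n + 3) * (1 + X) * h1 + X ^ (n + 2) * (1 - X ^ (3 * (n + 1))) * h0

end Recurrences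

section InfiniteSums

open Filter Topology
open Finset.HasAntidiagonal (antidiagonal mem_antidiagonal)

/-- The summand `q^{m(m+k)} / ((q)_m (q)_{m+k})` of the Durfee rectangle identity. -/
def rectTerm (k m : ℕ) : PowerSeries ℚ :=
  X ^ (m * (m + k)) * ((qp m)⁻¹ * (qp (m + k))⁻¹)

theorem X_pow_dvd_rectTerm (k m : ℕ) : X ^ m ∣ rectTerm k m :=
  Dvd.dvd.mul_right (pow_dvd_pow _ (by nlinarith [Nat.zero_le (m * k), Nat.le_mul_self m])) _

theorem summable_rectTerm (k : ℕ) : Summable (rectTerm k) :=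
  summable_nat_of_X_pow_dvd (X_pow_dvd_rectTerm k)

/-- The left-hand side of the Durfee rectangle identity. -/
def rectSum (k : ℕ) : PowerSeries ℚ := ∑' m, rectTerm k m

theorem rectTerm_eq (k m : ℕ) :
    rectTerm k m = (1 - X ^ (k + 1)) * rectTerm (k + 1) m +
      X ^ (m * (m + k)) * (1 - X ^ m) * ((qp m)⁻¹ * (qp (m + k + 1))⁻¹) := by
  unfold rectTerm
  rw [← qp_inv_succ_mul (m + k), show m * (m + (k + 1)) = m * (m + k) + m by ring, pow_add,
    ← add_assoc]
  ring

theorem rectTerm_shift (k m : ℕ) :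
    X ^ ((m + 1) * (m + 1 + k)) * (1 - X ^ (m + 1)) *
        ((qp (m + 1))⁻¹ * (qp (m + 1 + k + 1))⁻¹) =
      X ^ (k + 1) * rectTerm (k + 2) m := by
  unfold rectTerm
  rw [← qp_inv_succ_mul m, show m + 1 + k + 1 = m + (k + 2) by ring,
    show (m + 1) * (m + 1 + k) = k + 1 + m * (m + (k + 2)) by ring, pow_add]
  ring

theorem rectSum_rec (k : ℕ) :
    rectSum k = (1 - X ^ (k + 1)) * rectSum (k + 1) + X ^ (k + 1) * rectSum (k + 2) := by
  set g : ℕ → PowerSeries ℚ := fun m =>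
    X ^ (m * (m + k)) * (1 - X ^ m) * ((qp m)⁻¹ * (qp (m + k + 1))⁻¹) with hg
  have hg_succ : ∀ m, g (m + 1) = X ^ (k + 1) * rectTerm (k + 2) m := rectTerm_shift k
  have hg_sum : Summable g := by
    rw [← summable_nat_add_iff 1]
    simp_rw [hg_succ]
    exact (summable_rectTerm _).mul_left _
  have h : rectSum k = ∑' m, ((1 - X ^ (k + 1)) * rectTerm (k + 1) m + g m) :=
    tsum_congr (rectTerm_eq k)
  rw [h, ((summable_rectTerm _).mul_left _).tsum_add hg_sum, (summable_rectTerm _).tsum_mul_left,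
    hg_sum.tsum_eq_zero_add]
  simp_rw [hg_succ]
  rw [(summable_rectTerm _).tsum_mul_left]
  simp [hg, rectSum]

theorem X_pow_dvd_rectSum_sub (n k : ℕ) : X ^ n ∣ rectSum k - rectSum (k + 1) := by
  induction n generalizing k with
  | zero => simp
  | succ n ih =>
    have h : rectSum k - rectSum (k + 1) =
        -(X * (rectSum (k + 1) - rectSum (k + 2)) * X ^ k) := by
      rw [rectSum_rec k]
      ring
    rw [h, pow_succ']
    exact (Dvd.dvd.mul_right (mul_dvd_mul_left _ (ih (k + 1))) _).neg_right

theorem rectSum_eq_zero_index (k : ℕ) : rectSum k = rectSum 0 := by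
  induction k with
  | zero => rfl
  | succ k ih =>
    rw [← ih, eq_comm, ← sub_eq_zero]
    ext n
    exact X_pow_dvd_iff.1 (X_pow_dvd_rectSum_sub (n + 1) k) n n.lt_succ_self

theorem tendsto_qp : Tendsto qp atTop (𝓝 qpInf) := by
  have h := (multipliable_one_sub_X_pow_linear 1 one_pos).hasProd.tendsto_prod_nat
  simp only [one_mul, add_comm 1] at h
  exact h

theorem qpInf_mul_rectSum (k : ℕ) : qpInf * rectSum k = 1 := by
  have h : Tendsto (fun k => qp k * rectSum k) atTop (𝓝 1) := by
    refine tendsto_of_X_pow_dvd_sub fun k => ?_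
    have h0 : rectTerm k 0 = (qp k)⁻¹ := by simp [rectTerm, qp_inv_zero]
    have h1 : qp k * rectSum k - 1 = qp k * ∑' m, rectTerm k (m + 1) := by
      rw [rectSum, (summable_rectTerm k).tsum_eq_zero_add, h0]
      linear_combination qp_inv_mul k
    rw [h1]
    refine Dvd.dvd.mul_left (X_pow_dvd_tsum ((summable_nat_add_iff 1).2 (summable_rectTerm k))
      fun m => Dvd.dvd.mul_right (pow_dvd_pow _ ?_) _) _
    nlinarith [Nat.zero_le (m * (m + 1 + k))]
  rw [rectSum_eq_zero_index]
  simp_rw [rectSum_eq_zero_index] at h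
  exact tendsto_nhds_unique (tendsto_qp.mul_const _) h

/-- The generating function of `trinomialCoeff` at `t = q^k`. -/
def trinomialSum (k : ℕ) : PowerSeries ℚ := ∑' n, X ^ (k * n) * trinomialCoeff n

theorem summable_trinomial {k : ℕ} (hk : 0 < k) :
    Summable fun n => X ^ (k * n) * trinomialCoeff n :=
  summable_nat_of_X_pow_dvd fun n =>
    Dvd.dvd.mul_right (pow_dvd_pow _ (Nat.le_mul_of_pos_left n hk)) _

theorem trinomialSum_rec {k : ℕ} (hk : 0 < k) :
    trinomialSum k = (1 + X ^ k + X ^ (2 * k)) * trinomialSum (k + 1) := by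
  have hs := summable_trinomial hk
  have hs' := summable_trinomial (k := k + 1) k.succ_pos
  have hs1 := (summable_nat_add_iff 1).2 hs'
  have hd := hs.sub hs'
  have h : trinomialSum k - trinomialSum (k + 1) =
      X ^ k * trinomialSum (k + 1) + X ^ (2 * k) * trinomialSum (k + 1) := by
    have h2 : ∀ n, X ^ (k * (n + 1 + 1)) * trinomialCoeff (n + 1 + 1) -
        X ^ ((k + 1) * (n + 1 + 1)) * trinomialCoeff (n + 1 + 1) =
        X ^ k * (X ^ ((k + 1) * (n + 1)) * trinomialCoeff (n + 1)) +
          X ^ (2 * k) * (X ^ ((k + 1) * n) * trinomialCoeff n) := fun n => by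
      linear_combination X ^ (k * (n + 2)) * trinomialCoeff_rec n
    rw [trinomialSum, trinomialSum, ← hs.tsum_sub hs', hd.tsum_eq_zero_add,
      ((summable_nat_add_iff 1).2 hd).tsum_eq_zero_add, tsum_congr h2,
      (hs1.mul_left _).tsum_add (hs'.mul_left _), hs1.tsum_mul_left, hs'.tsum_mul_left]
    nth_rewrite 2 [hs'.tsum_eq_zero_add]
    simp only [mul_zero, pow_zero, sub_self, zero_add, mul_one, trinomialCoeff.eq_1]
    linear_combination X ^ k * trinomialCoeff_one
  linear_combination h

theorem qp_mul_trinomialSum (n : ℕ) :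
    qp n * trinomialSum 1 = qp3 n * trinomialSum (n + 1) := by
  induction n with
  | zero => rw [qp_zero, qp3_zero]
  | succ n ih =>
    rw [qp_succ, qp3_succ]
    linear_combination (1 - X ^ (n + 1)) * ih +
      (1 - X ^ (n + 1)) * qp3 n * trinomialSum_rec (k := n + 1) n.succ_pos

theorem tendsto_trinomialSum : Tendsto (fun n => trinomialSum (n + 1)) atTop (𝓝 1) := by
  refine tendsto_of_X_pow_dvd_sub fun n => ?_
  have hs := summable_trinomial (k := n + 1) n.succ_pos
  have h : trinomialSum (n + 1) - 1 =
      ∑' m, X ^ ((n + 1) * (m + 1)) * trinomialCoeff (m + 1) := by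
    rw [trinomialSum, hs.tsum_eq_zero_add]
    simp [trinomialCoeff.eq_1]
  rw [h]
  refine X_pow_dvd_tsum ((summable_nat_add_iff 1).2 hs)
    fun m => Dvd.dvd.mul_right (pow_dvd_pow _ ?_) _
  nlinarith

/-- `(q³;q³)_∞`. -/
def qp3Inf : PowerSeries ℚ := ∏' t : ℕ, (1 - (X : PowerSeries ℚ) ^ (3 + 3 * t))

theorem tendsto_qp3 : Tendsto qp3 atTop (𝓝 qp3Inf) := by
  have h := (multipliable_one_sub_X_pow_linear 3 three_pos).hasProd.tendsto_prod_nat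
  refine h.congr fun n => Finset.prod_congr rfl fun t _ => ?_
  rw [mul_add, mul_one, add_comm]

theorem qpInf_mul_trinomialSum : qpInf * trinomialSum 1 = qp3Inf := by
  refine tendsto_nhds_unique (tendsto_qp.mul_const _) ?_
  simp_rw [qp_mul_trinomialSum]
  simpa using tendsto_qp3.mul tendsto_trinomialSum

theorem qpInf_eq : qpInf = qp3Inf * (theta 1 6 * theta 2 6) := by
  have ht (a : ℕ) :=
    (multipliable_one_sub_X_pow_linear a (b := 6) (by norm_num)).hasProd.tendsto_prod_nat
  have h6 : Tendsto (fun n : ℕ => 6 * n) atTop atTop := tendsto_id.const_mul_atTop' (by norm_num)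
  have h2 : Tendsto (fun n : ℕ => 2 * n) atTop atTop := tendsto_id.const_mul_atTop' (by norm_num)
  refine tendsto_nhds_unique (tendsto_qp.comp h6) ?_
  refine ((tendsto_qp3.comp h2).mul
    (((ht 1).mul (ht (6 - 1))).mul ((ht 2).mul (ht (6 - 2))))).congr fun n => ?_
  simp only [Function.comp_apply]
  induction n with
  | zero => simp [qp_zero, qp3_zero]
  | succ n ih =>
    rw [show 2 * (n + 1) = 2 * n + 1 + 1 by ring,
      show 6 * (n + 1) = 6 * n + 1 + 1 + 1 + 1 + 1 + 1 by ring]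
    simp only [qp_succ, qp3_succ, Finset.prod_range_succ, ← ih]
    ring

theorem trinomialSum_one_mul_theta : trinomialSum 1 * (theta 1 6 * theta 2 6) = 1 := by
  have h0 : qpInf ≠ 0 := left_ne_zero_of_mul_eq_one (qpInf_mul_rectSum 0)
  refine mul_left_cancel₀ h0 ?_
  rw [← mul_assoc, qpInf_mul_trinomialSum, mul_one, ← qpInf_eq]

theorem cubic_summand_eq (r s : ℕ) :
    X ^ (r ^ 2 + s ^ 2 + s - r * s) * gbinom3 (r + s) r * (qp (r + s) * qp (r + s + 1))⁻¹ =
      cubicTerm r s * (qp3 (r + s) * ((qp (r + s))⁻¹ * (qp (r + s + 1))⁻¹)) := by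
  rw [gbinom3, if_pos (Nat.le_add_right r s), Nat.add_sub_cancel_left, cubicTerm,
    PowerSeries.mul_inv_rev, PowerSeries.mul_inv_rev]
  ring

theorem durfeeTerm_mul_qp_inv (m k : ℕ) :
    durfeeTerm m k * (qp (m + k + 1))⁻¹ =
      X ^ (1 * k) * trinomialCoeff k * rectTerm (k + 1) m := by
  rw [durfeeTerm, rectTerm, show (m + k) * (m + 1) = 1 * k + m * (m + (k + 1)) by ring, pow_add,
    add_assoc]
  ring

theorem sum_antidiagonal_cubic_summand (n : ℕ) :
    ∑ p ∈ antidiagonal n,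
        cubicTerm p.1 p.2 * (qp3 (p.1 + p.2) * ((qp (p.1 + p.2))⁻¹ * (qp (p.1 + p.2 + 1))⁻¹)) =
      ∑ p ∈ antidiagonal n, durfeeTerm p.1 p.2 * (qp (p.1 + p.2 + 1))⁻¹ := by
  trans cubicSum n * (qp3 n * ((qp n)⁻¹ * (qp (n + 1))⁻¹))
  · rw [cubicSum, Finset.sum_mul]
    exact Finset.sum_congr rfl fun p hp => by rw [mem_antidiagonal.1 hp]
  trans durfeeSum n * (qp (n + 1))⁻¹
  · linear_combination (qp n)⁻¹ * (qp (n + 1))⁻¹ * qp3_mul_cubicSum_eq n +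
      durfeeSum n * (qp (n + 1))⁻¹ * qp_inv_mul n
  · rw [durfeeSum, Finset.sum_mul]
    exact Finset.sum_congr rfl fun p hp => by rw [mem_antidiagonal.1 hp]

theorem summable_cubic_summand : Summable fun p : ℕ × ℕ =>
    cubicTerm p.1 p.2 *
      (qp3 (p.1 + p.2) * ((qp (p.1 + p.2))⁻¹ * (qp (p.1 + p.2 + 1))⁻¹)) := by
  refine summable_prod_of_X_pow_dvd (e := fun p => p.1 ^ 2 + p.2 ^ 2 + p.2 - p.1 * p.2) 4
    (fun p => ?_) fun p => ?_
  · exact Dvd.dvd.mul_right (Dvd.intro _ rfl) _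
  · have h := cubic_exponent_add p.1 p.2
    zify at h ⊢
    nlinarith [sq_nonneg ((p.1 : ℤ) - p.2), Int.le_self_sq ((p.1 : ℤ) + p.2)]

theorem summable_durfee : Summable fun p : ℕ × ℕ =>
    durfeeTerm p.1 p.2 * (qp (p.1 + p.2 + 1))⁻¹ := by
  refine summable_prod_of_X_pow_dvd (e := fun p => (p.1 + p.2) * (p.1 + 1)) 1
    (fun p => ?_) fun p => ?_
  · exact Dvd.dvd.mul_right (Dvd.intro _ rfl) _
  · nlinarith [Nat.zero_le ((p.1 + p.2) * p.1)]

theorem summable_rect : Summable fun p : ℕ × ℕ =>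
    X ^ (1 * p.1) * trinomialCoeff p.1 * rectTerm (p.1 + 1) p.2 := by
  have h := summable_durfee
  simp_rw [durfeeTerm_mul_qp_inv] at h
  exact h.prod_symm

theorem tsum_durfee_eq_tsum_rect :
    ∑' p : ℕ × ℕ, durfeeTerm p.1 p.2 * (qp (p.1 + p.2 + 1))⁻¹ =
      ∑' p : ℕ × ℕ, X ^ (1 * p.1) * trinomialCoeff p.1 * rectTerm (p.1 + 1) p.2 := by
  simp_rw [durfeeTerm_mul_qp_inv]
  exact (Equiv.prodComm ℕ ℕ).tsum_eq
    fun p : ℕ × ℕ => X ^ (1 * p.1) * trinomialCoeff p.1 * rectTerm (p.1 + 1) p.2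

theorem tsum_rect (k : ℕ) :
    ∑' m, X ^ (1 * k) * trinomialCoeff k * rectTerm (k + 1) m =
      X ^ (1 * k) * trinomialCoeff k * rectSum 0 := by
  rw [(summable_rectTerm (k + 1)).tsum_mul_left, ← rectSum_eq_zero_index (k + 1), rectSum]

theorem tsum_durfee :
    ∑' p : ℕ × ℕ, durfeeTerm p.1 p.2 * (qp (p.1 + p.2 + 1))⁻¹ =
      trinomialSum 1 * rectSum 0 := by
  have hs (k : ℕ) : Summable fun m => X ^ (1 * k) * trinomialCoeff k * rectTerm (k + 1) m :=
    (summable_rectTerm (k + 1)).mul_left _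
  rw [tsum_durfee_eq_tsum_rect, summable_rect.tsum_prod' hs]
  simp_rw [tsum_rect]
  rw [(summable_trinomial one_pos).tsum_mul_right, trinomialSum]

end InfiniteSums

/-- The mod 6 identity `eqn:210`:
`∑_{r,s ≥ 0} q^{r²−rs+s²+s} [r+s choose r]_{q³} / ((q)_{r+s} (q)_{r+s+1})
  = 1/((q;q)_∞ · θ(q;q⁶) · θ(q²;q⁶))`. -/
theorem statement19 :
    (∑' p : ℕ × ℕ,
      (fun (r s : ℕ) =>
        (X : PowerSeries ℚ) ^ (r ^ 2 + s ^ 2 + s - r * s) * gbinom3 (r + s) r *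
          (qp (r + s) * qp (r + s + 1))⁻¹)
      p.1 p.2)
      = (qpInf * theta 1 6 * theta 2 6)⁻¹ := by
  simp_rw [cubic_summand_eq]
  rw [tsum_prod_eq_tsum_antidiagonal summable_cubic_summand]
  simp_rw [sum_antidiagonal_cubic_summand]
  rw [← tsum_prod_eq_tsum_antidiagonal summable_durfee, tsum_durfee]
  have h : trinomialSum 1 * rectSum 0 * (qpInf * theta 1 6 * theta 2 6) = 1 := by
    linear_combination qpInf * rectSum 0 * trinomialSum_one_mul_theta + qpInf_mul_rectSum 0
  refine (PowerSeries.eq_inv_iff_mul_eq_one fun h0 => ?_).2 h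
  have hc := congrArg constantCoeff h
  rw [map_mul, h0] at hc
  simp at hc
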